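/- arXiv:2409.03883 — 6 statements merged into one kernel-verified Lean document; each statement's English description precedes it below -/
import Mathlib

section
/- Let n and p be finite types with a decidable equality, let Φ : Matrix n n ℂ, let M : Matrix p n ℂ, and for each row index ℓ : p let S ℓ be a finite subset of n such that M ℓ j = 0 for every j ∉ S ℓ (structural zeros outside the support). Assume that for every ℓ : p the principal submatrix of Φ obtained by restricting rows and columns to S ℓ is positive definite. If trace (M * Φ * Mᴴ) = 0, then M = 0. -/
open Matrix ComplexOrder

/-- A dot product with a vector supported on `s` can be computed on `s`. -/
theorem dotProduct_eq_sum_coe_of_support {n R : Type*} [Fintype n] [NonUnitalNonAssocSemiring R]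
    {v : n → R} (w : n → R) {s : Finset n} (hv : ∀ j, j ∉ s → v j = 0) :
    v ⬝ᵥ w = ∑ i : s, v i * w i := by
  rw [Finset.sum_coe_sort s (fun i => v i * w i)]
  exact (Finset.sum_subset s.subset_univ fun j _ hj => by rw [hv j hj, zero_mul]).symm

/-- The quadratic form of a vector supported on `s` is that of its restriction to `s` with respect
to the principal submatrix on `s`. -/
theorem dotProduct_mulVec_star_eq_submatrix_of_support {n R : Type*} [Fintype n] [CommRing R]
    [StarRing R] (Φ : Matrix n n R) {v : n → R} {s : Finset n} (hv : ∀ j, j ∉ s → v j = 0) :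
    v ⬝ᵥ (Φ *ᵥ star v) =
      star (fun i : s => star (v i)) ⬝ᵥ
        (Φ.submatrix (fun i : s => (i : n)) (fun i : s => (i : n)) *ᵥ fun i : s => star (v i)) := by
  rw [dotProduct_eq_sum_coe_of_support _ hv]
  refine Finset.sum_congr rfl fun i _ => ?_
  rw [Pi.star_apply, star_star, mulVec, dotProduct_comm,
    dotProduct_eq_sum_coe_of_support _ fun j hj => by rw [Pi.star_apply, hv j hj, star_zero]]
  exact congrArg _ (Finset.sum_congr rfl fun j _ => mul_comm _ _)

theorem structured_trace_eq_zero_implies_zero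
    {n p : Type*} [Fintype n] [Fintype p] [DecidableEq n] [DecidableEq p]
    (Φ : Matrix n n ℂ) (M : Matrix p n ℂ) (S : p → Finset n)
    (hsupp : ∀ ℓ : p, ∀ j : n, j ∉ S ℓ → M ℓ j = 0)
    (hΦ : ∀ ℓ : p,
      (Φ.submatrix (fun i : S ℓ => (i : n)) (fun i : S ℓ => (i : n))).PosDef)
    (htr : (M * Φ * Mᴴ).trace = 0) :
    M = 0 := by
  have hdiag (ℓ : p) : (M * Φ * Mᴴ) ℓ ℓ = star (fun i : S ℓ => star (M ℓ i)) ⬝ᵥ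
      (Φ.submatrix (fun i : S ℓ => (i : n)) (fun i : S ℓ => (i : n)) *ᵥ
        fun i : S ℓ => star (M ℓ i)) := by
    rw [← dotProduct_mulVec_star_eq_submatrix_of_support Φ (hsupp ℓ), Matrix.mul_assoc]
    rfl
  have hzero := (Finset.sum_eq_zero_iff_of_nonneg fun ℓ _ => by
    rw [diag_apply, hdiag]
    exact (hΦ ℓ).posSemidef.dotProduct_mulVec_nonneg _).1 htr
  ext ℓ j
  by_cases hj : j ∈ S ℓ
  · by_contra hM
    refine ((hΦ ℓ).dotProduct_mulVec_pos (x := fun i : S ℓ => star (M ℓ i)) fun h => hM ?_).ne'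
      ((hdiag ℓ).symm.trans (hzero ℓ (Finset.mem_univ ℓ)))
    exact star_eq_zero.1 (congrFun h ⟨j, hj⟩)
  · exact hsupp ℓ j hj
end

section
/- Let n and p be finite types with a decidable equality, let Φ : Matrix n n ℂ be positive semidefinite, let M : Matrix p n ℂ, fix a row index j : p, and let S be a finite subset of n such that M j k = 0 for every k ∉ S. Assume that the principal submatrix of Φ obtained by restricting rows and columns to S is positive definite. If trace (M * Φ * Mᴴ) = 0, then the j-th row of M is zero, i.e. M j = 0 (regardless of whether the other rows of M vanish). -/
open Matrix ComplexOrder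

/-- A quadratic form at a vector supported on `S` is that of the principal submatrix on `S`. -/
lemma Matrix.star_dotProduct_submatrix_mulVec_of_support {n : Type*} [Fintype n]
    (Φ : Matrix n n ℂ) (S : Finset n) (x : n → ℂ) (hx : ∀ k : n, k ∉ S → x k = 0) :
    star (fun i : S => x i) ⬝ᵥ
        (Φ.submatrix (fun i : S => (i : n)) (fun i : S => (i : n)) *ᵥ fun i : S => x i) =
      star x ⬝ᵥ (Φ *ᵥ x) := by
  have sum_eq (f : n → ℂ) (hf : ∀ k, k ∉ S → f k = 0) : ∑ i : S, f i = ∑ i, f i := by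
    rw [Finset.sum_coe_sort S f]
    exact Finset.sum_subset (Finset.subset_univ S) fun k _ hk => hf k hk
  simp only [dotProduct, mulVec, submatrix_apply, Pi.star_apply]
  rw [← sum_eq _ fun k hk => by simp [hx k hk]]
  refine Finset.sum_congr rfl fun i _ => ?_
  rw [← sum_eq _ fun k hk => by simp [hx k hk]]

theorem structured_trace_eq_zero_implies_row_zero
    {n p : Type*} [Fintype n] [Fintype p] [DecidableEq n] [DecidableEq p]
    (Φ : Matrix n n ℂ) (hΦ : Φ.PosSemidef) (M : Matrix p n ℂ)
    (j : p) (S : Finset n)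
    (hsupp : ∀ k : n, k ∉ S → M j k = 0)
    (hS : (Φ.submatrix (fun i : S => (i : n)) (fun i : S => (i : n))).PosDef)
    (htr : (M * Φ * Mᴴ).trace = 0) :
    M j = 0 := by
  have hpsd := hΦ.mul_mul_conjTranspose_same M
  have hdiag : (M * Φ * Mᴴ) j j = 0 :=
    (Finset.sum_eq_zero_iff_of_nonneg fun i _ => hpsd.diag_nonneg).mp htr j (Finset.mem_univ j)
  have hentry : (M * Φ * Mᴴ) j j = star (star (M j)) ⬝ᵥ (Φ *ᵥ star (M j)) := by
    rw [Matrix.mul_assoc, star_star]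
    rfl
  have hform := Matrix.star_dotProduct_submatrix_mulVec_of_support Φ S (star (M j))
    fun k hk => by simp [hsupp k hk]
  by_contra hne
  refine (hS.dotProduct_mulVec_pos (x := fun i : S => star (M j) i) fun hzero => hne ?_).ne'
    (hform.trans (hentry.symm.trans hdiag))
  ext k
  by_cases hk : k ∈ S
  · simpa using congrFun hzero ⟨k, hk⟩
  · exact hsupp k hk
end

section
/- Let n and p be finite types with decidable equality, fix j : p and a finite subset S of n, and let M : ℝ → Matrix p n ℂ and Φ : ℝ → Matrix n n ℂ be functions such that for Lebesgue-almost every ω ∈ [-π, π]: (i) Φ ω is positive semidefinite, (ii) M ω j k = 0 for every k ∉ S, and (iii) the principal submatrix of Φ ω on S is positive definite. Suppose ω ↦ (trace (M ω * Φ ω * (M ω)ᴴ)).re is integrable on [-π, π] with respect to Lebesgue measure and its integral over [-π, π] equals 0. Then for Lebesgue-almost every ω ∈ [-π, π] the j-th row of M ω is zero. -/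
open Matrix ComplexOrder MeasureTheory Real

/-- If the principal submatrix of `A` on `S` is positive definite, then the quadratic form of `A`
has no nontrivial zero supported on `S`. -/
theorem Matrix.eq_zero_of_posDef_submatrix {n : Type*} [Fintype n]
    {A : Matrix n n ℂ} {S : Finset n}
    (hA : (A.submatrix (fun i : S => (i : n)) (fun i : S => (i : n))).PosDef)
    {x : n → ℂ} (hx : ∀ k ∉ S, x k = 0) (h : star x ⬝ᵥ (A *ᵥ x) = 0) : x = 0 := by
  have sum_coe (f : n → ℂ) (hf : ∀ k ∉ S, f k = 0) : ∑ i : S, f i = ∑ k, f k := by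
    rw [Finset.sum_coe_sort S f]
    exact Finset.sum_subset S.subset_univ fun k _ hk => hf k hk
  have hform : star (fun i : S => x i) ⬝ᵥ
      (A.submatrix (fun i : S => (i : n)) (fun i : S => (i : n)) *ᵥ fun i : S => x i) =
      star x ⬝ᵥ (A *ᵥ x) := by
    simp only [dotProduct, mulVec, submatrix_apply, Pi.star_apply]
    rw [← sum_coe _ fun k hk => by simp [hx k hk]]
    refine Finset.sum_congr rfl fun i _ => ?_
    rw [sum_coe (fun k => A i k * x k) fun k hk => by simp [hx k hk]]
  have hres : (fun i : S => x i) = 0 := by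
    by_contra hne
    exact (hA.dotProduct_mulVec_pos hne).ne' (hform.trans h)
  funext k
  by_cases hk : k ∈ S
  · exact congrFun hres ⟨k, hk⟩
  · exact hx k hk

/-- A positive semidefinite matrix whose trace has zero real part has zero diagonal. -/
theorem Matrix.PosSemidef.diag_eq_zero_of_re_trace_eq_zero {p : Type*} [Fintype p]
    {B : Matrix p p ℂ} (hB : B.PosSemidef) (h : B.trace.re = 0) (j : p) : B j j = 0 := by
  have hnonneg (i : p) : 0 ≤ (B i i).re ∧ 0 = (B i i).im := Complex.nonneg_iff.mp hB.diag_nonneg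
  simp only [trace, diag_apply, Complex.re_sum] at h
  rw [Finset.sum_eq_zero_iff_of_nonneg fun i _ => (hnonneg i).1] at h
  exact Complex.ext (h j (Finset.mem_univ j)) (hnonneg j).2.symm

theorem ae_row_zero_of_integral_trace_eq_zero
    {n p : Type*} [Fintype n] [Fintype p] [DecidableEq n] [DecidableEq p]
    (j : p) (S : Finset n)
    (M : ℝ → Matrix p n ℂ) (Φ : ℝ → Matrix n n ℂ)
    (hae : ∀ᵐ ω ∂(volume.restrict (Set.Icc (-π) π)),
      (Φ ω).PosSemidef ∧ (∀ k : n, k ∉ S → M ω j k = 0) ∧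
      ((Φ ω).submatrix (fun i : S => (i : n)) (fun i : S => (i : n))).PosDef)
    (hint : IntegrableOn
      (fun ω => ((M ω * Φ ω * (M ω)ᴴ).trace).re) (Set.Icc (-π) π) volume)
    (hzero : ∫ ω in Set.Icc (-π) π, ((M ω * Φ ω * (M ω)ᴴ).trace).re = 0) :
    ∀ᵐ ω ∂(volume.restrict (Set.Icc (-π) π)), M ω j = 0 := by
  have hnonneg : 0 ≤ᵐ[volume.restrict (Set.Icc (-π) π)]
      fun ω => ((M ω * Φ ω * (M ω)ᴴ).trace).re := by
    filter_upwards [hae] with ω hω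
    exact (Complex.nonneg_iff.mp (hω.1.mul_mul_conjTranspose_same (M ω)).trace_nonneg).1
  filter_upwards [hae, (integral_eq_zero_iff_of_nonneg_ae hnonneg hint).mp hzero]
    with ω ⟨hΦ, hsupp, hpos⟩ htrace
  have hjj := (hΦ.mul_mul_conjTranspose_same (M ω)).diag_eq_zero_of_re_trace_eq_zero htrace j
  rw [← star_eq_zero]
  refine Matrix.eq_zero_of_posDef_submatrix hpos (fun k hk => by simp [hsupp k hk]) ?_
  rw [← hjj, star_star, Matrix.mul_assoc]
  rfl
end

section
/- Let K be a field, let V be a finite type with decidable equality, let B : Matrix V V K, and suppose 1 - B is invertible (its determinant is a unit). Let i j : V and suppose there is no walk from j to i in the digraph of B, i.e. ¬ Relation.ReflTransGen (fun a b => B b a ≠ 0) j i. Then the (i, j) entry of the inverse matrix (1 - B)⁻¹ is 0. -/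
open Matrix

theorem inv_one_sub_entry_eq_zero_of_no_walk
    {K : Type*} [Field K] {V : Type*} [Fintype V] [DecidableEq V]
    (B : Matrix V V K) (hB : IsUnit (1 - B).det) (i j : V)
    (hwalk : ¬ Relation.ReflTransGen (fun a b => B b a ≠ 0) j i) :
    (1 - B)⁻¹ i j = 0 := by
  classical
  let f : V → ℕ := fun v => if Relation.ReflTransGen (fun a b => B b a ≠ 0) j v then 0 else 1
  have hf : BlockTriangular (1 - B) f := by
    intro b a hab
    have ha : Relation.ReflTransGen (fun a b => B b a ≠ 0) j a := by
      by_contra ha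
      simp only [f, if_neg ha] at hab
      split_ifs at hab <;> omega
    have hb : ¬ Relation.ReflTransGen (fun a b => B b a ≠ 0) j b := by
      intro hb
      simp [f, hb] at hab
    have hne : b ≠ a := fun h => hb (h ▸ ha)
    have hzero : B b a = 0 := by
      by_contra h
      exact hb (ha.tail h)
    simp [hne, hzero]
  let _ : Invertible (1 - B) := invertibleOfIsUnitDet _ hB
  apply blockTriangular_inv_of_blockTriangular hf
  simp [f, hwalk, Relation.ReflTransGen.refl]
end

section
/- Let K be a field, let S and F be finite types with decidable equality, let A : Matrix S S K, B : Matrix S F K, C : Matrix F S K, D : Matrix F F K, and suppose 1 - D is invertible (its determinant is a unit). Define the immersed matrix G̃ := A + B * (1 - D)⁻¹ * C. Then for all k l : S, if G̃ k l ≠ 0, then either A k l ≠ 0, or there exist f f' : F with C f l ≠ 0, a walk from f to f' in the digraph of D (i.e. Relation.ReflTransGen (fun a b => D b a ≠ 0) f f'), and B k f' ≠ 0. -/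
open Matrix

/-- A nonzero entry `(f', f)` of `(1 - D)⁻¹` forces a walk from `f` to `f'` in the digraph of `D`. -/
theorem reflTransGen_of_inv_one_sub_apply_ne_zero
    {K : Type*} [Field K] {F : Type*} [Fintype F] [DecidableEq F] (D : Matrix F F K)
    (hD : IsUnit (1 - D).det) {f f' : F} (h : (1 - D)⁻¹ f' f ≠ 0) :
    Relation.ReflTransGen (fun a b => D b a ≠ 0) f f' := by
  classical
  by_contra hf'
  let _ := invertibleOfIsUnitDet (1 - D) hD
  let level : F → ℕ := fun v => if Relation.ReflTransGen (fun a b => D b a ≠ 0) f v then 0 else 1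
  have hlevel {i j : F} : level j < level i ↔
      Relation.ReflTransGen (fun a b => D b a ≠ 0) f j ∧
        ¬ Relation.ReflTransGen (fun a b => D b a ≠ 0) f i := by
    dsimp only [level]
    split_ifs <;> simp_all
  have htri : (1 - D).BlockTriangular level := by
    intro i j hij
    obtain ⟨hj, hi⟩ := hlevel.mp hij
    have hne : i ≠ j := by
      rintro rfl
      exact hi hj
    have hDij : D i j = 0 := by
      by_contra hne'
      exact hi (hj.tail hne')
    simp [one_apply_ne hne, hDij]
  exact h (blockTriangular_inv_of_blockTriangular htri (hlevel.mpr ⟨.refl, hf'⟩))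

theorem immersed_nonzero_entry_structure
    {K : Type*} [Field K] {S F : Type*} [Fintype S] [Fintype F]
    [DecidableEq S] [DecidableEq F]
    (A : Matrix S S K) (B : Matrix S F K) (C : Matrix F S K) (D : Matrix F F K)
    (hD : IsUnit (1 - D).det) :
    ∀ k l : S, (A + B * (1 - D)⁻¹ * C) k l ≠ 0 →
      A k l ≠ 0 ∨ ∃ f f' : F, C f l ≠ 0 ∧
        Relation.ReflTransGen (fun a b => D b a ≠ 0) f f' ∧ B k f' ≠ 0 := by
  intro k l h
  by_cases hA : A k l = 0
  · rw [Matrix.add_apply, hA, zero_add, mul_apply] at h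
    obtain ⟨f, -, hf⟩ := Finset.exists_ne_zero_of_sum_ne_zero h
    have hBN := left_ne_zero_of_mul hf
    rw [mul_apply] at hBN
    obtain ⟨f', -, hf'⟩ := Finset.exists_ne_zero_of_sum_ne_zero hBN
    exact Or.inr ⟨f, f', right_ne_zero_of_mul hf,
      reflTransGen_of_inv_one_sub_apply_ne_zero D hD (right_ne_zero_of_mul hf'),
      left_ne_zero_of_mul hf'⟩
  · exact Or.inl hA
end

section
/- Let V be a finite type with decidable equality, and let G be a square matrix over the field RatFunc ℝ of real rational functions, indexed by V. Let D and T be finite subsets of V with T ∩ D = ∅. Define G_cut : Matrix V V (RatFunc ℝ) by (G_cut) i j = if j ∈ D then 0 else G i j, and suppose both 1 - G and 1 - G_cut are invertible (their determinants are units). Then there exist matrices T_s : Matrix T D (RatFunc ℝ) and R_s : Matrix T V (RatFunc ℝ) such that: (i) for every t ∈ T and s ∈ V, if there is no D-avoiding walk from s to t, i.e. ¬ Relation.ReflTransGen (fun a b => a ∉ D ∧ G b a ≠ 0) s ↑t, then R_s t s = 0; and (ii) for every x : V → RatFunc ℝ, setting w := (1 - G)⁻¹ *ᵥ x, one has for every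 t ∈ T: w ↑t = (T_s *ᵥ fun d : D => w ↑d) t + (R_s *ᵥ x) t. -/
open Matrix

/-- If `1 - A` is invertible, then `(1 - A)⁻¹ t s` vanishes unless the digraph of `A` contains a
walk from `s` to `t`. -/
theorem Matrix.inv_one_sub_apply_eq_zero_of_not_reflTransGen
    {V R : Type*} [Fintype V] [DecidableEq V] [CommRing R]
    (A : Matrix V V R) (hA : IsUnit (1 - A).det) {s t : V}
    (hst : ¬ Relation.ReflTransGen (fun a b => A b a ≠ 0) s t) :
    (1 - A)⁻¹ t s = 0 := by
  classical
  let reachable : V → Prop := Relation.ReflTransGen (fun a b => A b a ≠ 0) s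
  let b : V → ℕ := fun i => if reachable i then 0 else 1
  have hblock : (1 - A).BlockTriangular b := by
    intro i j hij
    have hj : reachable j := by
      by_contra hj
      simp only [b, if_neg hj] at hij
      split_ifs at hij <;> omega
    have hi : ¬ reachable i := fun hi => by simp [b, hi] at hij
    have hne : i ≠ j := fun h => hi (h ▸ hj)
    have hz : A i j = 0 := by
      by_contra h
      exact hi (hj.tail h)
    simp [hne, hz]
  have : Invertible (1 - A) := invertibleOfIsUnitDet _ hA
  have hs : reachable s := Relation.ReflTransGen.refl
  have ht : ¬ reachable t := hst
  exact blockTriangular_inv_of_blockTriangular hblock (by simp [b, hs, ht])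

theorem disconnecting_set_decomposition
    {V : Type*} [Fintype V] [DecidableEq V]
    (G : Matrix V V (RatFunc ℝ)) (D T : Finset V) (hTD : T ∩ D = ∅)
    (Gcut : Matrix V V (RatFunc ℝ))
    (hGcut : ∀ i j, Gcut i j = if j ∈ D then 0 else G i j)
    (hG : IsUnit (1 - G).det) (hGc : IsUnit (1 - Gcut).det) :
    ∃ (Ts : Matrix T D (RatFunc ℝ)) (Rs : Matrix T V (RatFunc ℝ)),
      (∀ (t : T) (s : V),
        ¬ Relation.ReflTransGen (fun a b => a ∉ D ∧ G b a ≠ 0) s (↑t : V) →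
          Rs t s = 0) ∧
      (∀ x : V → RatFunc ℝ,
        ∀ t : T, ((1 - G)⁻¹ *ᵥ x) (↑t : V) =
          (Ts *ᵥ fun d : D => ((1 - G)⁻¹ *ᵥ x) (↑d : V)) t + (Rs *ᵥ x) t) := by
  refine ⟨fun t d => ((1 - Gcut)⁻¹ * G) t d, fun t s => (1 - Gcut)⁻¹ t s, ?_, ?_⟩
  · intro t s hts
    refine Matrix.inv_one_sub_apply_eq_zero_of_not_reflTransGen Gcut hGc fun h => hts ?_
    refine Relation.ReflTransGen.mono (fun a b hab => ?_) _ _ h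
    rw [hGcut] at hab
    simpa using hab
  · intro x t
    set w := (1 - G)⁻¹ *ᵥ x with hw
    have hx : (1 - G) *ᵥ w = x := by
      rw [hw, mulVec_mulVec, mul_nonsing_inv _ hG, one_mulVec]
    have hsplit : (1 - Gcut) *ᵥ w = (G - Gcut) *ᵥ w + x := by
      rw [← hx, ← add_mulVec]
      congr 1
      abel
    have hsol : w = ((1 - Gcut)⁻¹ * (G - Gcut)) *ᵥ w + (1 - Gcut)⁻¹ *ᵥ x := by
      rw [← mulVec_mulVec, ← mulVec_add, ← hsplit, mulVec_mulVec, nonsing_inv_mul _ hGc,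
        one_mulVec]
    have hcol : ∀ j, ((1 - Gcut)⁻¹ * (G - Gcut)) t j =
        if j ∈ D then ((1 - Gcut)⁻¹ * G) t j else 0 := by
      intro j
      split_ifs with hj <;> simp [mul_apply, hGcut, hj]
    have hD : (((1 - Gcut)⁻¹ * (G - Gcut)) *ᵥ w) t =
        ∑ d : D, ((1 - Gcut)⁻¹ * G) t d * w d := by
      simp only [mulVec, dotProduct, hcol, ite_mul, zero_mul]
      rw [Finset.sum_ite_mem, Finset.univ_inter]
      exact (Finset.sum_coe_sort D fun j => ((1 - Gcut)⁻¹ * G) t j * w j).symm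
    calc w t = (((1 - Gcut)⁻¹ * (G - Gcut)) *ᵥ w) t + ((1 - Gcut)⁻¹ *ᵥ x) (t : V) :=
          congrFun hsol t
      _ = _ := by rw [hD]; rfl
end
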